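/- For k ≥ 3, there exists a k-edge-coloring of the complete graph on N vertices with no rainbow triangle and no monochromatic copy of S_8^2, where N = 14·5^{(k-2)/2} + (1/2)·5^{(k-4)/2} - 1/2 if k is even and N = 7·5^{(k-1)/2} + (1/4)·5^{(k-3)/2} - 1/4 if k is odd; hence gr_k(K_3 ; S_8^2) > N. -/

import Mathlib

/-- `SGraph t r` is the graph `S_t^r`: a star `K_{1,t-1}` with center `0`
together with `r` independent edges `(1,2), (3,4), …, (2r-1,2r)` among the leaves. -/
def SGraph (t r : ℕ) : SimpleGraph (Fin t) :=
  SimpleGraph.fromRel fun a b =>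
    a.val = 0 ∨ (b.val = a.val + 1 ∧ a.val % 2 = 1 ∧ b.val ≤ 2 * r)

/-- A monochromatic copy of `H` in the edge-coloring `c` of the complete graph on `V`. -/
def HasMonoCopy {α V C : Type*} (H : SimpleGraph α) (c : Sym2 V → C) : Prop :=
  ∃ (f : α ↪ V) (col : C), ∀ a b : α, H.Adj a b → c s(f a, f b) = col

/-- A copy of `H` in the edge-coloring `c` all of whose edges get color `col`. -/
def HasMonoCopyCol {α V C : Type*} (H : SimpleGraph α) (c : Sym2 V → C) (col : C) : Prop :=
  ∃ f : α ↪ V, ∀ a b : α, H.Adj a b → c s(f a, f b) = col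

/-- A rainbow triangle in the edge-coloring `c` of the complete graph on `V`. -/
def HasRainbowTriangle {V C : Type*} (c : Sym2 V → C) : Prop :=
  ∃ x y z : V,
    c s(x, y) ≠ c s(y, z) ∧ c s(y, z) ≠ c s(x, z) ∧ c s(x, y) ≠ c s(x, z)

theorem HasRainbowTriangle.of_comp_map {V W C : Type*} {c : Sym2 W → C} (f : V → W)
    (h : HasRainbowTriangle (c ∘ Sym2.map f)) : HasRainbowTriangle c := by
  obtain ⟨x, y, z, h⟩ := h
  exact ⟨f x, f y, f z, by simpa using h⟩

theorem HasMonoCopy.of_comp_map {α V W C : Type*} {H : SimpleGraph α} {c : Sym2 W → C}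
    (f : V ↪ W) (h : HasMonoCopy H (c ∘ Sym2.map f)) : HasMonoCopy H c := by
  obtain ⟨g, col, h⟩ := h
  exact ⟨g.trans f, col, by simpa using h⟩

theorem HasRainbowTriangle.comp_injective {V C D : Type*} {c : Sym2 V → C} {g : C → D}
    (hg : g.Injective) (h : HasRainbowTriangle c) : HasRainbowTriangle (g ∘ c) := by
  obtain ⟨x, y, z, h₁, h₂, h₃⟩ := h
  exact ⟨x, y, z, hg.ne h₁, hg.ne h₂, hg.ne h₃⟩

theorem HasMonoCopy.comp {α V C D : Type*} {H : SimpleGraph α} {c : Sym2 V → C} (g : C → D)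
    (h : HasMonoCopy H c) : HasMonoCopy H (g ∘ c) := by
  obtain ⟨f, col, h⟩ := h
  exact ⟨f, g col, fun a b hab => congrArg g (h a b hab)⟩

/-- The coloring of the disjoint union of the `V i` given by `c i` inside `V i` and by the
reduced coloring `r` between different parts. -/
def blowUp {I : Type*} [DecidableEq I] {V : I → Type*} {C : Type*} (r : Sym2 I → C)
    (c : ∀ i, Sym2 (V i) → C) : Sym2 (Σ i, V i) → C :=
  Sym2.lift ⟨fun x y => if h : x.1 = y.1 then c y.1 s(h ▸ x.2, y.2) else r s(x.1, y.1), by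
    rintro ⟨i, x⟩ ⟨j, y⟩
    by_cases h : i = j
    · subst h
      simp [Sym2.eq_swap]
    · simp [h, Ne.symm h, Sym2.eq_swap]⟩

section BlowUp

variable {I : Type*} [DecidableEq I] {V : I → Type*} {C : Type*} {r : Sym2 I → C}
  {c : ∀ i, Sym2 (V i) → C}

@[simp]
theorem blowUp_same (i : I) (x y : V i) : blowUp r c s(⟨i, x⟩, ⟨i, y⟩) = c i s(x, y) := by
  simp [blowUp]

theorem blowUp_of_ne {x y : Σ i, V i} (h : x.1 ≠ y.1) :
    blowUp r c s(x, y) = r s(x.1, y.1) := by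
  simp [blowUp, h]

theorem blowUp_cases (e : Sym2 (Σ i, V i)) :
    (∃ i j, i ≠ j ∧ blowUp r c e = r s(i, j)) ∨
      ∃ i, ∃ e' : Sym2 (V i), e = e'.map (Sigma.mk i) ∧ blowUp r c e = c i e' := by
  induction e with | _ x y => ?_
  obtain ⟨i, x⟩ := x
  obtain ⟨j, y⟩ := y
  by_cases h : i = j
  · subst h
    exact .inr ⟨i, s(x, y), by simp⟩
  · exact .inl ⟨i, j, h, blowUp_of_ne h⟩

theorem not_hasRainbowTriangle_blowUp (hr : ¬ HasRainbowTriangle r)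
    (hc : ∀ i, ¬ HasRainbowTriangle (c i)) : ¬ HasRainbowTriangle (blowUp r c) := by
  rintro ⟨⟨i, x⟩, ⟨j, y⟩, ⟨l, z⟩, h⟩
  by_cases hij : i = j
  · subst hij
    by_cases hil : i = l
    · subst hil
      exact hc i ⟨x, y, z, by simpa using h⟩
    · simp [blowUp_of_ne, hil] at h
  · by_cases hjl : j = l
    · subst hjl
      simp [blowUp_of_ne, hij] at h
    · by_cases hil : i = l
      · subst hil
        simp [blowUp_of_ne, hij, Sym2.eq_swap] at h
      · exact hr ⟨i, j, l, by simpa [blowUp_of_ne, hij, hjl, hil] using h⟩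

/-- If the reduced coloring has no monochromatic triangle and its color `a` occurs inside one part
`V i₀` only, then a triangle of color `a` has an edge in `V i₀`. -/
theorem exists_edge_of_blowUp_triangle {i₀ : I} {a : C}
    (hr : ∀ i j l, i ≠ j → j ≠ l → i ≠ l → r s(i, j) = r s(j, l) → r s(j, l) ≠ r s(i, l))
    (ha : ∀ i, i ≠ i₀ → ∀ e, c i e ≠ a) {x y z : Σ i, V i} (hxy : x ≠ y) (hyz : y ≠ z)
    (hxz : x ≠ z) (h₁ : blowUp r c s(x, y) = a) (h₂ : blowUp r c s(y, z) = a)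
    (h₃ : blowUp r c s(x, z) = a) :
    ∃ u v : V i₀, u ≠ v ∧ c i₀ s(u, v) = a ∧
      (⟨i₀, u⟩ = x ∨ ⟨i₀, u⟩ = y ∨ ⟨i₀, u⟩ = z) ∧ (⟨i₀, v⟩ = x ∨ ⟨i₀, v⟩ = y ∨ ⟨i₀, v⟩ = z) := by
  have key : ∀ p q : Σ i, V i, p.1 = q.1 → p ≠ q → blowUp r c s(p, q) = a →
      ∃ u v : V i₀, u ≠ v ∧ c i₀ s(u, v) = a ∧ ⟨i₀, u⟩ = p ∧ ⟨i₀, v⟩ = q := by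
    rintro ⟨i, p⟩ ⟨j, q⟩ hpq hne h
    obtain rfl : i = j := hpq
    rw [blowUp_same] at h
    obtain rfl : i = i₀ := by
      by_contra hi
      exact ha i hi _ h
    exact ⟨p, q, by simpa using hne, h, rfl, rfl⟩
  by_cases h₁' : x.1 = y.1
  · obtain ⟨u, v, huv, h, hu, hv⟩ := key x y h₁' hxy h₁
    exact ⟨u, v, huv, h, by tauto, by tauto⟩
  by_cases h₂' : y.1 = z.1
  · obtain ⟨u, v, huv, h, hu, hv⟩ := key y z h₂' hyz h₂
    exact ⟨u, v, huv, h, by tauto, by tauto⟩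
  by_cases h₃' : x.1 = z.1
  · obtain ⟨u, v, huv, h, hu, hv⟩ := key x z h₃' hxz h₃
    exact ⟨u, v, huv, h, by tauto, by tauto⟩
  rw [blowUp_of_ne h₁'] at h₁
  rw [blowUp_of_ne h₂'] at h₂
  rw [blowUp_of_ne h₃'] at h₃
  exact absurd (h₂.trans h₃.symm) (hr _ _ _ h₁' h₂' h₃' (h₁.trans h₂.symm))

theorem SGraph_adj_zero {t : ℕ} [NeZero t] (r : ℕ) {j : Fin t} (hj : j ≠ 0) :
    (SGraph t r).Adj 0 j := by
  simp [SGraph, hj.symm]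

theorem not_hasMonoCopy_blowUp {i₀ : I}
    (hr : ∀ i j l, i ≠ j → j ≠ l → i ≠ l → r s(i, j) = r s(j, l) → r s(j, l) ≠ r s(i, l))
    (hne : ∀ e i, i ≠ i₀ → ∀ e', c i e' ≠ r e)
    (hsub : ∀ e, (c i₀ ⁻¹' {r e}).Subsingleton)
    (hc : ∀ i, ¬ HasMonoCopy (SGraph 8 2) (c i)) :
    ¬ HasMonoCopy (SGraph 8 2) (blowUp r c) := by
  rintro ⟨f, a, h⟩
  by_cases hf : ∀ j, (f j).1 = (f 0).1
  · have hg : ∀ j, ∃ x : V (f 0).1, f j = ⟨(f 0).1, x⟩ := fun j =>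
      ⟨hf j ▸ (f j).2, Sigma.ext (hf j) (by simp)⟩
    choose g hg using hg
    refine hc (f 0).1 ⟨⟨g, fun j l hjl => f.injective ?_⟩, a, fun j l hjl => ?_⟩
    · rw [hg j, hg l, hjl]
    · rw [← h j l hjl, hg j, hg l, blowUp_same]
      rfl
  push Not at hf
  obtain ⟨j, hj⟩ := hf
  have haj := h 0 j (SGraph_adj_zero 2 (by rintro rfl; exact hj rfl))
  rw [blowUp_of_ne hj.symm] at haj
  have ha := hne s((f 0).1, (f j).1)
  have hs := hsub s((f 0).1, (f j).1)
  rw [haj] at ha hs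
  have hd : ∀ {p q : Fin 8}, p ≠ q → f p ≠ f q := fun hpq => f.injective.ne hpq
  have h12 : (SGraph 8 2).Adj 1 2 := by simp [SGraph]
  have h34 : (SGraph 8 2).Adj 3 4 := by simp [SGraph]
  obtain ⟨u, v, huv, he, hu, hv⟩ := exists_edge_of_blowUp_triangle hr ha
    (hd (p := 0) (q := 1) (by decide)) (hd (p := 1) (q := 2) (by decide)) (hd (by decide))
    (h 0 1 (SGraph_adj_zero 2 (by decide))) (h 1 2 h12) (h 0 2 (SGraph_adj_zero 2 (by decide)))
  obtain ⟨u', v', huv', he', hu', hv'⟩ := exists_edge_of_blowUp_triangle hr ha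
    (hd (p := 0) (q := 3) (by decide)) (hd (p := 3) (q := 4) (by decide)) (hd (by decide))
    (h 0 3 (SGraph_adj_zero 2 (by decide))) (h 3 4 h34) (h 0 4 (SGraph_adj_zero 2 (by decide)))
  have meet : ∀ w : V i₀, (⟨i₀, w⟩ = f 0 ∨ ⟨i₀, w⟩ = f 1 ∨ ⟨i₀, w⟩ = f 2) →
      (⟨i₀, w⟩ = f 0 ∨ ⟨i₀, w⟩ = f 3 ∨ ⟨i₀, w⟩ = f 4) → (⟨i₀, w⟩ : Σ i, V i) = f 0 := by
    rintro w (h | h | h) (h' | h' | h') <;> first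
      | exact h
      | exact h'
      | exact absurd (h.symm.trans h') (hd (by decide))
  have heq : s(u, v) = s(u', v') := hs he he'
  have huv₀ : (⟨i₀, u⟩ : Σ i, V i) = f 0 ∧ (⟨i₀, v⟩ : Σ i, V i) = f 0 := by
    rcases Sym2.eq_iff.1 heq with ⟨rfl, rfl⟩ | ⟨rfl, rfl⟩
    · exact ⟨meet _ hu hu', meet _ hv hv'⟩
    · exact ⟨meet _ hu hv', meet _ hv hu'⟩
  exact huv (by simpa using huv₀.1.trans huv₀.2.symm)

end BlowUp

/-- There is a coloring of `K_n` with no rainbow triangle and no monochromatic `S_8^2` that uses the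
colors in `A` freely and each color in `S` on at most one edge. -/
def Avoidable (A S : Set ℕ) (n : ℕ) : Prop :=
  ∃ c : Sym2 (Fin n) → ℕ, ¬ HasRainbowTriangle c ∧ ¬ HasMonoCopy (SGraph 8 2) c ∧
    (∀ e, c e ∈ A ∪ S) ∧ ∀ a ∈ S, (c ⁻¹' {a}).Subsingleton

theorem Avoidable.of_fintype {V : Type*} [Fintype V] {A S : Set ℕ} (c : Sym2 V → ℕ)
    (h₁ : ¬ HasRainbowTriangle c) (h₂ : ¬ HasMonoCopy (SGraph 8 2) c) (h₃ : ∀ e, c e ∈ A ∪ S)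
    (h₄ : ∀ a ∈ S, (c ⁻¹' {a}).Subsingleton) : Avoidable A S (Fintype.card V) := by
  let φ := (Fintype.equivFin V).symm
  refine ⟨c ∘ Sym2.map φ, fun h => h₁ h.of_comp_map, fun h => h₂ (h.of_comp_map φ.toEmbedding),
    fun e => h₃ _, fun a ha e he e' he' => ?_⟩
  exact Sym2.map.injective φ.injective (h₄ a ha he he')

theorem Avoidable.blowUp {I : Type*} [Fintype I] [DecidableEq I] {r : Sym2 I → ℕ} {A R : Set ℕ}
    {S : I → Set ℕ} {n : I → ℕ} (i₀ : I) (hr : ¬ HasRainbowTriangle r)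
    (htri : ∀ i j l, i ≠ j → j ≠ l → i ≠ l → r s(i, j) = r s(j, l) → r s(j, l) ≠ r s(i, l))
    (hrR : ∀ e, r e ∈ R) (hAR : Disjoint A R) (hAS : ∀ i, Disjoint A (S i))
    (hRS : ∀ i, i ≠ i₀ → Disjoint R (S i)) (hSS : Pairwise fun i j => Disjoint (S i) (S j))
    (h : ∀ i, Avoidable A (S i) (n i)) :
    Avoidable (A ∪ R) ((⋃ i, S i) \ R) (∑ i, n i) := by
  choose c hrb hmono hmem hsub using h
  have hout : ∀ e, ∀ i, i ≠ i₀ → ∀ e', c i e' ≠ r e := fun e i hi e' he => by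
    rcases hmem i e' with h | h
    · exact Set.disjoint_left.1 hAR h (he ▸ hrR e)
    · exact Set.disjoint_left.1 (hRS i hi) (he ▸ hrR e) h
  have hin : ∀ e, (c i₀ ⁻¹' {r e}).Subsingleton := fun e => by
    by_cases h : r e ∈ S i₀
    · exact hsub i₀ _ h
    · intro e' he'
      have : c i₀ e' = r e := he'
      rcases hmem i₀ e' with h' | h'
      · exact absurd (hrR e) (Set.disjoint_left.1 hAR (this ▸ h'))
      · exact absurd (this ▸ h') h
  have := Avoidable.of_fintype (A := A ∪ R) (S := (⋃ i, S i) \ R) (_root_.blowUp r c)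
    (not_hasRainbowTriangle_blowUp hr hrb) (not_hasMonoCopy_blowUp htri hout hin hmono) ?_ ?_
  · simpa using this
  · intro e
    rcases blowUp_cases (r := r) (c := c) e with ⟨i, j, -, he⟩ | ⟨i, e', -, he⟩
    · rw [he]
      exact .inl (.inr (hrR _))
    · rw [he]
      by_cases hR : c i e' ∈ R
      · exact .inl (.inr hR)
      · rcases hmem i e' with h | h
        · exact .inl (.inl h)
        · exact .inr ⟨Set.mem_iUnion.2 ⟨i, h⟩, hR⟩
  · rintro a ⟨ha, haR⟩
    obtain ⟨i, hi⟩ := Set.mem_iUnion.1 ha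
    have key : ∀ e, _root_.blowUp r c e = a → ∃ e' : Sym2 (Fin (n i)),
        e = e'.map (Sigma.mk i) ∧ c i e' = a := by
      intro e he
      rcases blowUp_cases (r := r) (c := c) e with ⟨j, l, -, hj⟩ | ⟨j, e', hee, hj⟩
      · exact absurd (he ▸ hj ▸ hrR _) haR
      · have hja : c j e' = a := hj.symm.trans he
        have hjS : a ∈ S j := by
          rcases hmem j e' with h | h
          · exact absurd hi (Set.disjoint_left.1 (hAS i) (hja ▸ h))
          · exact hja ▸ h
        obtain rfl : j = i := by
          by_contra hne
          exact Set.disjoint_left.1 (hSS hne) hjS hi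
        exact ⟨e', hee, hja⟩
    intro e he e' he'
    obtain ⟨d, rfl, hd⟩ := key e he
    obtain ⟨d', rfl, hd₂⟩ := key e' he'
    exact congrArg _ (hsub i a hi hd hd₂)

/-- The coloring of `K_5` by two pentagons with colors `a` and `b`. -/
def pentagon (a b : ℕ) : Sym2 (Fin 5) → ℕ :=
  Sym2.lift ⟨fun i j => if j = i + 1 ∨ i = j + 1 then a else b, fun i j => by simp [or_comm]⟩

theorem Avoidable.pentagon {A : Set ℕ} {a b : ℕ} (hab : a ≠ b) (ha : a ∉ A) (hb : b ∉ A)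
    {S : Fin 5 → Set ℕ} {n : Fin 5 → ℕ} (hAS : ∀ i, Disjoint A (S i))
    (hRS : ∀ i, i ≠ 0 → Disjoint {a, b} (S i)) (hSS : Pairwise fun i j => Disjoint (S i) (S j))
    (h : ∀ i, Avoidable A (S i) (n i)) :
    Avoidable (A ∪ {a, b}) ((⋃ i, S i) \ {a, b}) (∑ i, n i) := by
  refine Avoidable.blowUp (r := _root_.pentagon a b) 0 ?_ ?_ ?_ ?_ hAS hRS hSS h
  · rintro ⟨i, j, l, h₁, h₂, h₃⟩
    simp only [_root_.pentagon, Sym2.lift_mk] at h₁ h₂ h₃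
    split_ifs at h₁ h₂ h₃ <;> simp_all
  · intro i j l hij hjl hil h₁ h₂
    simp only [_root_.pentagon, Sym2.lift_mk] at h₁ h₂
    split_ifs at h₁ h₂ <;> first
      | exact hab h₁
      | exact hab h₁.symm
      | exact hab h₂
      | exact hab h₂.symm
      | omega
  · intro e
    induction e with | _ i j => ?_
    simp only [_root_.pentagon, Sym2.lift_mk]
    split_ifs <;> simp
  · rw [Set.disjoint_right]
    rintro x (rfl | rfl) <;> assumption

theorem Avoidable.double {A : Set ℕ} {a n : ℕ} (ha : a ∉ A) (h : Avoidable A ∅ n) :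
    Avoidable (A ∪ {a}) ∅ (2 * n) := by
  have := Avoidable.blowUp (r := fun _ : Sym2 (Fin 2) => a) (A := A) (R := {a}) (S := fun _ => ∅)
    (n := fun _ => n) 0 (by simp [HasRainbowTriangle]) (fun i j l _ _ _ _ => by omega) (by simp) (by simpa)
    (by simp) (by simp) (fun _ _ _ => by simp) (fun _ => h)
  simpa using this

theorem avoidable_seven : Avoidable {0} ∅ 7 := by
  refine ⟨fun _ => 0, by simp [HasRainbowTriangle], ?_, by simp, by simp⟩
  rintro ⟨f, -⟩
  simpa using Fintype.card_le_of_embedding f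

/-- The complete graph on `Fin 4 × Bool` in color `0`, with the perfect matching between the
`(i, false)` and the `(i, true)` recolored by four colors used once each. -/
theorem avoidable_eight {g : Fin 4 → ℕ} (hg : g.Injective) (h0 : ∀ i, g i ≠ 0) :
    Avoidable {0} (Set.range g) 8 := by
  let c : Sym2 (Fin 4 × Bool) → ℕ := Sym2.lift
    ⟨fun x y => if x.1 = y.1 ∧ x.2 ≠ y.2 then g x.1 else 0, fun x y => by
      by_cases h : x.1 = y.1 <;> simp [h, eq_comm]⟩
  have hc : ∀ x y, c s(x, y) = if x.1 = y.1 ∧ x.2 ≠ y.2 then g x.1 else 0 := fun _ _ => rfl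
  have hedge : ∀ i e, c e = g i → e = s((i, false), (i, true)) := by
    intro i e he
    induction e with | _ x y => ?_
    obtain ⟨x, p⟩ := x
    obtain ⟨y, q⟩ := y
    rw [hc] at he
    split_ifs at he with h
    · obtain rfl : x = i := hg he
      obtain ⟨rfl, h⟩ := h
      cases p <;> cases q <;> simp_all
    · exact absurd he.symm (h0 i)
  have := Avoidable.of_fintype (A := {0}) (S := Set.range g) c ?_ ?_ ?_ ?_
  · simpa using this
  · rintro ⟨⟨x, p⟩, ⟨y, q⟩, ⟨z, s⟩, h₁, h₂, h₃⟩
    simp only [hc] at h₁ h₂ h₃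
    by_cases hxy : x = y
    · subst hxy
      by_cases hxz : x = z
      · subst hxz
        cases p <;> cases q <;> cases s <;> simp_all
      · simp_all
    · by_cases hyz : y = z <;> simp_all
  · rintro ⟨f, a, h⟩
    have hf : Function.Bijective f :=
      (Fintype.bijective_iff_injective_and_card f).2 ⟨f.injective, by simp⟩
    obtain ⟨j, hj⟩ := hf.2 ((f 0).1, !(f 0).2)
    have hj0 : j ≠ 0 := by
      rintro rfl
      simpa using congrArg Prod.snd hj
    obtain ⟨l, hl⟩ := hf.2 ((f 0).1 + 1, true)
    have hl0 : l ≠ 0 := by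
      rintro rfl
      simpa using congrArg Prod.fst hl
    have h₁ := h 0 j (SGraph_adj_zero 2 hj0)
    have h₂ := h 0 l (SGraph_adj_zero 2 hl0)
    rw [hj, hc] at h₁
    rw [hl, hc] at h₂
    simp at h₁ h₂
    exact h0 _ (h₁.trans h₂.symm)
  · intro e
    induction e with | _ x y => ?_
    rw [hc]
    split_ifs <;> simp
  · rintro _ ⟨i, rfl⟩ e he e' he'
    exact (hedge i e he).trans (hedge i e' he').symm

/-- `n` vertices can be colored with `k` colors, and one more vertex can be added at the cost of
two further colors on one edge each. -/
def Extendable (k n : ℕ) : Prop :=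
  Avoidable (Set.Iio k) ∅ n ∧
    ∀ a b, k ≤ a → k ≤ b → a ≠ b → Avoidable (Set.Iio k) {a, b} (n + 1)

theorem extendable_three : Extendable 3 35 := by
  have hI : Set.Iio 3 = ({0} ∪ {1, 2} : Set ℕ) := by
    ext x
    simp
    omega
  constructor
  · have := Avoidable.pentagon (A := {0}) (a := 1) (b := 2) (S := fun _ => ∅) (n := fun _ => 7)
      (by simp) (by simp) (by simp) (by simp) (by simp) (fun _ _ _ => by simp)
      (fun _ => avoidable_seven)
    simpa [hI] using this
  · intro a b ha hb hab
    let S : Fin 5 → Set ℕ := fun i => if i = 0 then Set.range ![1, 2, a, b] else ∅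
    have := Avoidable.pentagon (A := {0}) (a := 1) (b := 2) (S := S)
      (n := fun i => if i = 0 then 8 else 7)
      (by simp) (by simp) (by simp) (fun i => ?_) (fun i hi => by simp [S, hi])
      (fun i j hij => ?_) (fun i => ?_)
    · have hS : (⋃ i, S i) \ {1, 2} = {a, b} := by
        have : (⋃ i, S i) = Set.range ![1, 2, a, b] := by simp [S, Set.iUnion_ite]
        rw [this]
        ext x
        simp
        omega
      rw [hS, ← hI] at this
      simpa [Fin.sum_univ_succ] using this
    · by_cases hi : i = 0
      · simp [S, hi]
        omega
      · simp [S, hi]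
    · by_cases hi : i = 0
      · simp [S, hi, show j ≠ 0 by rintro rfl; exact hij hi]
      · simp [S, hi]
    · by_cases hi : i = 0
      · simp only [S, hi, if_true]
        refine avoidable_eight ?_ ?_
        · intro i j h
          fin_cases i <;> fin_cases j <;> simp at h ⊢ <;> omega
        · intro i
          fin_cases i <;> simp <;> omega
      · simpa [S, hi] using avoidable_seven

theorem Extendable.succ {k n : ℕ} (h : Extendable k n) : Extendable (k + 2) (5 * n + 1) := by
  obtain ⟨h₁, h₂⟩ := h
  have hI : Set.Iio (k + 2) = (Set.Iio k ∪ {k, k + 1} : Set ℕ) := by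
    ext x
    simp
    omega
  have hk := h₂ k (k + 1) le_rfl (by omega) (by omega)
  constructor
  · let S : Fin 5 → Set ℕ := fun i => if i = 0 then {k, k + 1} else ∅
    have := Avoidable.pentagon (A := Set.Iio k) (a := k) (b := k + 1) (S := S)
      (n := fun i => if i = 0 then n + 1 else n)
      (by simp) (by simp) (by simp) (fun i => ?_) (fun i hi => by simp [S, hi])
      (fun i j hij => ?_) (fun i => ?_)
    · have hS : (⋃ i, S i) \ {k, k + 1} = ∅ := by simp [S, Set.iUnion_ite]
      rw [hS, ← hI] at this
      convert this using 1
      simp [Fin.sum_univ_succ]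
      omega
    · by_cases hi : i = 0
      · simp [S, hi]
      · simp [S, hi]
    · by_cases hi : i = 0
      · simp [S, hi, show j ≠ 0 by rintro rfl; exact hij hi]
      · simp [S, hi]
    · by_cases hi : i = 0
      · simpa [S, hi] using hk
      · simpa [S, hi] using h₁
  · intro a b ha hb hab
    have hab' := h₂ a b (by omega) (by omega) hab
    let S : Fin 5 → Set ℕ := fun i => if i = 0 then {k, k + 1} else if i = 1 then {a, b} else ∅
    have hdisj : Disjoint ({k, k + 1} : Set ℕ) {a, b} := by
      simp
      omega
    have := Avoidable.pentagon (A := Set.Iio k) (a := k) (b := k + 1) (S := S)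
      (n := fun i => if i = 0 then n + 1 else if i = 1 then n + 1 else n)
      (by simp) (by simp) (by simp) (fun i => ?_) (fun i hi => ?_)
      (fun i j hij => ?_) (fun i => ?_)
    · have hS : (⋃ i, S i) \ {k, k + 1} = {a, b} := by
        have : (⋃ i, S i) = {k, k + 1} ∪ {a, b} := by
          ext x
          simp [S, Fin.exists_fin_succ]
          tauto
        rw [this, Set.union_sdiff_left, hdisj.sdiff_eq_right]
      rw [hS, ← hI] at this
      convert this using 1
      simp [Fin.sum_univ_succ]
      omega
    · rw [Set.disjoint_left]
      intro x hx hxS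
      simp only [S] at hxS
      split_ifs at hxS <;> simp at hx hxS <;> omega
    · by_cases hi1 : i = 1
      · simpa [S, hi1] using hdisj
      · simp [S, hi, hi1]
    · simp only [S]
      split_ifs <;> first
        | exact hdisj
        | exact hdisj.symm
        | exact Set.disjoint_empty _
        | exact Set.empty_disjoint _
        | (exfalso; omega)
    · simp only [S]
      split_ifs
      exacts [hk, hab', h₁]

theorem exists_extendable (m : ℕ) :
    ∃ n : ℕ, (n : ℚ) = 7 * 5 ^ (m + 1) + (1 / 4) * 5 ^ m - 1 / 4 ∧ Extendable (2 * m + 3) n := by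
  induction m with
  | zero => exact ⟨35, by norm_num, extendable_three⟩
  | succ m ih =>
    obtain ⟨n, hn, h⟩ := ih
    refine ⟨5 * n + 1, ?_, h.succ⟩
    push_cast
    rw [hn]
    ring

theorem Avoidable.exists_coloring {k n : ℕ} (h : Avoidable (Set.Iio k) ∅ n) :
    ∃ c : Sym2 (Fin n) → Fin k, ¬ HasRainbowTriangle c ∧ ¬ HasMonoCopy (SGraph 8 2) c := by
  obtain ⟨c, h₁, h₂, h₃, -⟩ := h
  have hlt : ∀ e, c e < k := by simpa using h₃
  obtain ⟨c, rfl⟩ : ∃ c' : Sym2 (Fin n) → Fin k, c = Fin.val ∘ c' :=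
    ⟨fun e => ⟨c e, hlt e⟩, rfl⟩
  exact ⟨c, fun h => h₁ (h.comp_injective Fin.val_injective), fun h => h₂ (h.comp Fin.val)⟩

theorem lt_of_forall_coloring {N k n : ℕ} {c : Sym2 (Fin N) → Fin k}
    (h₁ : ¬ HasRainbowTriangle c) (h₂ : ¬ HasMonoCopy (SGraph 8 2) c)
    (h : ∀ c : Sym2 (Fin n) → Fin k, HasRainbowTriangle c ∨ HasMonoCopy (SGraph 8 2) c) :
    N < n := by
  by_contra! hle
  rcases h (c ∘ Sym2.map (Fin.castLEEmb hle)) with h | h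
  · exact h₁ h.of_comp_map
  · exact h₂ (h.of_comp_map _)

theorem gallai_ramsey_S82_lower (k : ℕ) (hk : 3 ≤ k) :
    ∃ N : ℕ,
      (Even k → (N : ℚ) = 14 * 5 ^ ((k - 2) / 2) + (1 / 2) * 5 ^ ((k - 4) / 2) - 1 / 2) ∧
      (Odd k → (N : ℚ) = 7 * 5 ^ ((k - 1) / 2) + (1 / 4) * 5 ^ ((k - 3) / 2) - 1 / 4) ∧
      (∃ c : Sym2 (Fin N) → Fin k,
        ¬ HasRainbowTriangle c ∧ ¬ HasMonoCopy (SGraph 8 2) c) ∧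
      (∀ n : ℕ, (∀ c : Sym2 (Fin n) → Fin k,
          HasRainbowTriangle c ∨ HasMonoCopy (SGraph 8 2) c) → N < n) := by
  suffices ∃ N : ℕ,
      (Even k → (N : ℚ) = 14 * 5 ^ ((k - 2) / 2) + (1 / 2) * 5 ^ ((k - 4) / 2) - 1 / 2) ∧
      (Odd k → (N : ℚ) = 7 * 5 ^ ((k - 1) / 2) + (1 / 4) * 5 ^ ((k - 3) / 2) - 1 / 4) ∧
      Avoidable (Set.Iio k) ∅ N by
    obtain ⟨N, heven, hodd, h⟩ := this
    obtain ⟨c, h₁, h₂⟩ := h.exists_coloring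
    exact ⟨N, heven, hodd, ⟨c, h₁, h₂⟩, fun n hn => lt_of_forall_coloring h₁ h₂ hn⟩
  rcases Nat.even_or_odd k with hk' | hk'
  · obtain ⟨m, rfl⟩ : ∃ m, k = 2 * m + 3 + 1 := by
      obtain ⟨j, rfl⟩ := hk'
      exact ⟨j - 2, by omega⟩
    obtain ⟨n, hn, h, -⟩ := exists_extendable m
    refine ⟨2 * n, fun _ => ?_, fun ho => absurd hk' (Nat.not_even_iff_odd.2 ho), ?_⟩
    · rw [show (2 * m + 3 + 1 - 2) / 2 = m + 1 by omega,
        show (2 * m + 3 + 1 - 4) / 2 = m by omega]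
      push_cast
      rw [hn]
      ring
    · have hI : Set.Iio (2 * m + 3 + 1) = Set.Iio (2 * m + 3) ∪ {2 * m + 3} := by
        ext x
        simp
      rw [hI]
      exact h.double (by simp)
  · obtain ⟨m, rfl⟩ : ∃ m, k = 2 * m + 3 := by
      obtain ⟨j, rfl⟩ := hk'
      exact ⟨j - 1, by omega⟩
    obtain ⟨n, hn, h, -⟩ := exists_extendable m
    refine ⟨n, fun he => absurd hk' (Nat.not_odd_iff_even.2 he), fun _ => ?_, h⟩
    rw [show (2 * m + 3 - 1) / 2 = m + 1 by omega, show (2 * m + 3 - 3) / 2 = m by omega]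
    exact hn
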